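/- arXiv:1709.02168 — 2 statements merged into one kernel-verified Lean document; each statement's English description precedes it below -/
import Mathlib

section
/- Non-asymptotic strong converse bound: for every blocklength n, every R ≥ 0, and every synthesis code with (1/n) log|ℳ_n| ≤ R, the induced distribution satisfies |P_{X^nY^n} − π_{X^nY^n}| ≥ 1 − 4 exp(−n F(R)), where F(R) is the strong converse exponent defined below. -/
open Filter

noncomputable section

/-- `P` is a probability mass function on the finite type `α`. -/
def IsPMF {α : Type*} [Fintype α] (P : α → ℝ) : Prop :=
  (∀ a, 0 ≤ P a) ∧ (∑ a, P a) = 1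

/-- Rényi divergence of order `1 + s` (natural logarithm), `EReal`-valued.
For `s ≥ 0` it is `⊤` when `supp P ⊄ supp Q`; for `s = 0` it is the relative
entropy; otherwise it is `(1/s) log ∑_{x ∈ supp P} P(x)^{1+s} Q(x)^{-s}`. -/
def renyiDiv {α : Type*} [Fintype α] (s : ℝ) (P Q : α → ℝ) : EReal :=
  if 0 ≤ s ∧ ∃ a, 0 < P a ∧ Q a = 0 then ⊤
  else if s = 0 then
    (((∑ a ∈ Finset.univ.filter (fun a => 0 < P a), P a * Real.log (P a / Q a)) : ℝ) : EReal)
  else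
    ((((1 / s) * Real.log (∑ a ∈ Finset.univ.filter (fun a => 0 < P a),
        P a ^ (1 + s) * Q a ^ (-s))) : ℝ) : EReal)

/-- Mutual information `I(XY; W)` of a joint distribution on `(X × Y) × W`. -/
def mutualInfoW {X Y W : Type*} [Fintype X] [Fintype Y] [Fintype W] (P : X × Y × W → ℝ) : ℝ :=
  ∑ z ∈ Finset.univ.filter (fun z : X × Y × W => 0 < P z),
    P z * Real.log (P z /
      ((∑ w, P (z.1, z.2.1, w)) * (∑ p : X × Y, P (p.1, p.2, z.2.2))))

/-- The Markov chain condition `X − W − Y`. -/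
def IsMarkovXWY {X Y W : Type*} [Fintype X] [Fintype Y] [Fintype W] (P : X × Y × W → ℝ) : Prop :=
  ∀ x y w, P (x, y, w) * (∑ p : X × Y, P (p.1, p.2, w)) =
    (∑ y', P (x, y', w)) * (∑ x', P (x', y, w))

/-- Wyner's common information of the target distribution `π` on `X × Y`. -/
def CWyner {X Y : Type*} [Fintype X] [Fintype Y] (π : X × Y → ℝ) : ℝ :=
  sInf { r | ∃ P : X × Y × Fin (Fintype.card X * Fintype.card Y) → ℝ,
    IsPMF P ∧ (∀ x y, (∑ w, P (x, y, w)) = π (x, y)) ∧ IsMarkovXWY P ∧ r = mutualInfoW P }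

/-- The message set size `⌈e^{nR}⌉` of a rate-`R` synthesis code at blocklength `n`. -/
def numMsgs (R : ℝ) (n : ℕ) : ℕ := ⌈Real.exp (n * R)⌉₊

/-- A synthesis code: a pair of conditional distributions from the message set to
`X^n` and `Y^n` respectively. -/
structure SynthCode (X Y : Type*) [Fintype X] [Fintype Y] (M n : ℕ) where
  PX : Fin M → (Fin n → X) → ℝ
  PY : Fin M → (Fin n → Y) → ℝ
  PX_pmf : ∀ m, IsPMF (PX m)
  PY_pmf : ∀ m, IsPMF (PY m)

/-- The distribution `P_{X^n Y^n}` induced by a synthesis code. -/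
def SynthCode.induced {X Y : Type*} [Fintype X] [Fintype Y] {M n : ℕ}
    (c : SynthCode X Y M n) : (Fin n → X) × (Fin n → Y) → ℝ :=
  fun z => (M : ℝ)⁻¹ * ∑ m, c.PX m z.1 * c.PY m z.2

/-- The `n`-fold product distribution `π^{⊗ n}` on `X^n × Y^n`. -/
def prodDist {X Y : Type*} [Fintype X] [Fintype Y] (π : X × Y → ℝ) (n : ℕ) :
    (Fin n → X) × (Fin n → Y) → ℝ :=
  fun z => ∏ i, π (z.1 i, z.2 i)

/-- Total variation distance between two distributions on a finite type. -/
def tvDist {α : Type*} [Fintype α] (P Q : α → ℝ) : ℝ :=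
  (∑ a, |P a - Q a|) / 2

/-- Marginal `Q_U` of a distribution on `X × Y × U`. -/
def margU {X Y U : Type*} [Fintype X] [Fintype Y] [Fintype U] (Q : X × Y × U → ℝ) (u : U) : ℝ :=
  ∑ p : X × Y, Q (p.1, p.2, u)

/-- Marginal `Q_{XU}` of a distribution on `X × Y × U`. -/
def margXU {X Y U : Type*} [Fintype X] [Fintype Y] [Fintype U] (Q : X × Y × U → ℝ)
    (x : X) (u : U) : ℝ := ∑ y, Q (x, y, u)

/-- Marginal `Q_{YU}` of a distribution on `X × Y × U`. -/
def margYU {X Y U : Type*} [Fintype X] [Fintype Y] [Fintype U] (Q : X × Y × U → ℝ)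
    (y : Y) (u : U) : ℝ := ∑ x, Q (x, y, u)

/-- Marginal `Q_{XY}` of a distribution on `X × Y × U`. -/
def margXY {X Y U : Type*} [Fintype X] [Fintype Y] [Fintype U] (Q : X × Y × U → ℝ)
    (x : X) (y : Y) : ℝ := ∑ u, Q (x, y, u)

/-- The set `𝒬` of distributions `Q_{XYU}` on `X × Y × U` (with `|U| = |X||Y|`)
whose `X × Y` marginal is supported inside `supp π`. -/
def QClass {X Y : Type*} [Fintype X] [Fintype Y] (π : X × Y → ℝ) :
    Set (X × Y × Fin (Fintype.card X * Fintype.card Y) → ℝ) :=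
  { Q | IsPMF Q ∧ ∀ x y, 0 < margXY Q x y → 0 < π (x, y) }

/-- The linear combination of likelihood ratios `ω^{(α)}_{Q_{XYU}}(x,y|u)`:
`ᾱ ( log (Q_{XY}/π) + log (Q_{XY|U}/(Q_{X|U}Q_{Y|U})) ) + α log (Q_{XY|U}/π)`. -/
def omegaFn {X Y U : Type*} [Fintype X] [Fintype Y] [Fintype U] (π : X × Y → ℝ) (α : ℝ)
    (Q : X × Y × U → ℝ) (z : X × Y × U) : ℝ :=
  (1 - α) * (Real.log (margXY Q z.1 z.2.1 / π (z.1, z.2.1)) +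
      Real.log (Q z * margU Q z.2.2 / (margXU Q z.1 z.2.2 * margYU Q z.2.1 z.2.2))) +
    α * Real.log (Q z / (margU Q z.2.2 * π (z.1, z.2.1)))

/-- The negative cumulant generating function `Ω^{(α,θ)}(Q_{XYU})`. -/
def OmegaQ {X Y U : Type*} [Fintype X] [Fintype Y] [Fintype U] (π : X × Y → ℝ) (α θ : ℝ)
    (Q : X × Y × U → ℝ) : ℝ :=
  -Real.log (∑ z ∈ Finset.univ.filter (fun z : X × Y × U => 0 < Q z),
    Q z * Real.exp (-(θ * omegaFn π α Q z)))

/-- The minimized negative cumulant generating function `Ω^{(α,θ)}`. -/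
def OmegaMin {X Y : Type*} [Fintype X] [Fintype Y] (π : X × Y → ℝ) (α θ : ℝ) : ℝ :=
  sInf { r | ∃ Q ∈ QClass π, r = OmegaQ π α θ Q }

/-- The exponent `F^{(α,θ)}(R) = (Ω^{(α,θ)} − θαR)/(1 + (5−3α)θ)`. -/
def Fat {X Y : Type*} [Fintype X] [Fintype Y] (π : X × Y → ℝ) (α θ R : ℝ) : ℝ :=
  (OmegaMin π α θ - θ * α * R) / (1 + (5 - 3 * α) * θ)

/-- The strong converse exponent `F(R) = sup_{(α,θ) ∈ [0,1]×[0,∞)} F^{(α,θ)}(R)`. -/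
def Fexp {X Y : Type*} [Fintype X] [Fintype Y] (π : X × Y → ℝ) (R : ℝ) : ℝ :=
  sSup { r | ∃ α ∈ Set.Icc (0 : ℝ) 1, ∃ θ ∈ Set.Ici (0 : ℝ), r = Fat π α θ R }

/-- Among nonnegative combinations of nonnegative vectors `s v` reproducing `∑ v, s v`, one with at
most `card A` nonzero coefficients does at least as well for the linear objective `h`. -/
lemma exists_small_support_combination {A V : Type*} [Fintype A] [Fintype V]
    (s : V → A → ℝ) (hs : ∀ v a, 0 ≤ s v a) (h : V → ℝ) (h0 : ∀ v, s v = 0 → h v = 0) :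
    ∃ c : V → ℝ, (∀ v, 0 ≤ c v) ∧ (∀ a, ∑ v, c v * s v a = ∑ v, s v a) ∧
      ∑ v, h v ≤ ∑ v, c v * h v ∧
      (Finset.univ.filter (fun v => c v ≠ 0)).card ≤ Fintype.card A := by
  classical
  suffices H : ∀ N : ℕ, ∀ c : V → ℝ, (Finset.univ.filter (fun v => c v ≠ 0)).card = N →
      (∀ v, 0 ≤ c v) → (∀ v, s v = 0 → c v = 0) →
      (∀ a, ∑ v, c v * s v a = ∑ v, s v a) → ∑ v, h v ≤ ∑ v, c v * h v →
      ∃ c : V → ℝ, (∀ v, 0 ≤ c v) ∧ (∀ a, ∑ v, c v * s v a = ∑ v, s v a) ∧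
        ∑ v, h v ≤ ∑ v, c v * h v ∧
        (Finset.univ.filter (fun v => c v ≠ 0)).card ≤ Fintype.card A by
    refine H _ (fun v => if s v = 0 then 0 else 1) rfl (fun v => ?_) (fun v hv => by simp [hv])
      (fun a => Finset.sum_congr rfl fun v _ => ?_) (Finset.sum_le_sum fun v _ => ?_)
    · split_ifs <;> norm_num
    · split_ifs with hv <;> simp [hv]
    · split_ifs with hv <;> simp [hv, h0]
  intro N
  induction N using Nat.strong_induction_on with
  | _ N ih =>
  intro c hN hc hc0 hsum hobj
  by_cases hle : (Finset.univ.filter (fun v => c v ≠ 0)).card ≤ Fintype.card A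
  · exact ⟨c, hc, hsum, hobj, hle⟩
  obtain ⟨d, hdsupp, hdsum, hdobj, v₀, hv₀⟩ : ∃ d : V → ℝ, (∀ v, c v = 0 → d v = 0) ∧
      (∀ a, ∑ v, d v * s v a = 0) ∧ 0 ≤ ∑ v, d v * h v ∧ ∃ v, d v < 0 := by
    have hdep : ¬ LinearIndependent ℝ (fun v : {v // c v ≠ 0} => s v.1) := by
      intro hli
      have := hli.fintype_card_le_finrank
      rw [Module.finrank_fintype_fun_eq_card, Fintype.card_subtype] at this
      exact hle this
    obtain ⟨e, he, i, hi⟩ := Fintype.not_linearIndependent_iff.1 hdep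
    set d : V → ℝ := fun v => if hv : c v ≠ 0 then e ⟨v, hv⟩ else 0 with hd
    have hd0 : ∀ v, c v = 0 → d v = 0 := fun v hv => by simp [hd, hv]
    have hdi : d i.1 ≠ 0 := by simpa [hd, i.2] using hi
    have hds : ∀ a, ∑ v, d v * s v a = 0 := by
      intro a
      have h1 := congrFun he a
      simp only [Finset.sum_apply, Pi.smul_apply, smul_eq_mul, Pi.zero_apply] at h1
      rw [← Finset.sum_filter_of_ne (p := fun v => c v ≠ 0)
        (fun v _ hv hcv => hv (by simp [hd0 v hcv])),
        Finset.sum_subtype (p := fun v => c v ≠ 0) _ (by simp)]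
      refine Eq.trans ?_ h1
      exact Finset.sum_congr rfl fun v _ => by simp [hd, v.2]
    have hneg : ∀ d : V → ℝ, (∀ v, c v = 0 → d v = 0) → (∀ a, ∑ v, d v * s v a = 0) →
        d i.1 ≠ 0 → ∃ v, d v < 0 := by
      intro d hd0 hds hdi
      by_contra! hpos
      have hz : ∀ a, s i.1 a = 0 := by
        intro a
        have := (Finset.sum_eq_zero_iff_of_nonneg
          (fun v _ => mul_nonneg (hpos v) (hs v a))).1 (hds a) i.1 (Finset.mem_univ _)
        exact (mul_eq_zero.1 this).resolve_left hdi
      exact i.2 (hc0 _ (funext hz))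
    rcases le_total 0 (∑ v, d v * h v) with hob | hob
    · exact ⟨d, hd0, hds, hob, hneg d hd0 hds hdi⟩
    · have hds' : ∀ a, ∑ v, (-d v) * s v a = 0 := fun a => by
        simp [neg_mul, Finset.sum_neg_distrib, hds a]
      refine ⟨fun v => -d v, fun v hv => by simp [hd0 v hv], hds', ?_,
        hneg _ (fun v hv => by simp [hd0 v hv]) hds' (by simpa using hdi)⟩
      simpa [neg_mul, Finset.sum_neg_distrib] using hob
  obtain ⟨w, hw, hwmin⟩ := Finset.exists_min_image (Finset.univ.filter (fun v => d v < 0))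
    (fun v => c v / (-d v)) ⟨v₀, by simpa using hv₀⟩
  have hdw : d w < 0 := by simpa using hw
  set t : ℝ := c w / (-d w) with ht
  have ht0 : 0 ≤ t := div_nonneg (hc w) (by linarith)
  have hcw : c w ≠ 0 := fun h => hdw.ne (hdsupp w h)
  have htw : c w + t * d w = 0 := by
    rw [ht, div_neg, neg_mul, div_mul_cancel₀ _ hdw.ne, add_neg_cancel]
  refine ih _ ?_ (fun v => c v + t * d v) rfl (fun v => ?_) (fun v hv => ?_) (fun a => ?_) ?_
  · rw [← hN]
    refine Finset.card_lt_card ((Finset.ssubset_iff_of_subset fun v hv => ?_).2 ⟨w, ?_, ?_⟩)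
    · simp only [Finset.mem_filter, Finset.mem_univ, true_and] at hv ⊢
      intro h
      exact hv (by simp [h, hdsupp v h])
    · simpa using hcw
    · simpa using htw
  · rcases le_or_gt 0 (d v) with hv | hv
    · exact add_nonneg (hc v) (mul_nonneg ht0 hv)
    · have := hwmin v (by simpa using hv)
      rw [le_div_iff₀ (by linarith)] at this
      linarith
  · simp [hc0 v hv, hdsupp v (hc0 v hv)]
  · simp only [add_mul, Finset.sum_add_distrib, mul_assoc, ← Finset.mul_sum, hdsum a, hsum a]
    simp
  · simp only [add_mul, Finset.sum_add_distrib, mul_assoc, ← Finset.mul_sum]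
    nlinarith [mul_nonneg ht0 hdobj]

/-- The contribution of the slice `s = Q(·, ·, u)` to `exp (-Ω^{(α,θ)}(Q))` when `Q_{XY} = m`. -/
def sliceMoment {X Y : Type*} [Fintype X] [Fintype Y] (π : X × Y → ℝ) (α θ : ℝ)
    (m : X × Y → ℝ) (s : X × Y → ℝ) : ℝ :=
  ∑ p ∈ Finset.univ.filter (fun p => 0 < s p), s p * Real.exp (-(θ *
    ((1 - α) * (Real.log (m p / π p) +
      Real.log (s p * (∑ q, s q) / ((∑ y, s (p.1, y)) * (∑ x, s (x, p.2))))) +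
      α * Real.log (s p / ((∑ q, s q) * π p)))))

lemma sum_exp_eq_sum_sliceMoment {X Y U : Type*} [Fintype X] [Fintype Y] [Fintype U]
    (π : X × Y → ℝ) (α θ : ℝ) (Q : X × Y × U → ℝ) :
    ∑ z ∈ Finset.univ.filter (fun z : X × Y × U => 0 < Q z),
      Q z * Real.exp (-(θ * omegaFn π α Q z)) =
      ∑ u, sliceMoment π α θ (fun p => margXY Q p.1 p.2) (fun p => Q (p.1, p.2, u)) := by
  simp only [sliceMoment, Finset.sum_filter]
  rw [← Fintype.sum_prod_type']
  exact Fintype.sum_equiv ((Equiv.prodAssoc X Y U).symm.trans (Equiv.prodComm _ _)) _ _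
    fun z => rfl

lemma sliceMoment_zero {X Y : Type*} [Fintype X] [Fintype Y] (π : X × Y → ℝ) (α θ : ℝ)
    (m : X × Y → ℝ) : sliceMoment π α θ m 0 = 0 := by
  simp [sliceMoment]

lemma sliceMoment_smul {X Y : Type*} [Fintype X] [Fintype Y] (π : X × Y → ℝ) (α θ : ℝ)
    (m : X × Y → ℝ) {c : ℝ} (hc : 0 ≤ c) (s : X × Y → ℝ) :
    sliceMoment π α θ m (c • s) = c * sliceMoment π α θ m s := by
  rcases hc.eq_or_lt with rfl | hc
  · simp [sliceMoment]
  simp only [sliceMoment, Pi.smul_apply, smul_eq_mul, mul_pos_iff_of_pos_left hc,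
    ← Finset.mul_sum, mul_assoc]
  congr 1
  refine Finset.sum_congr rfl fun p _ => ?_
  have h1 : c * (s p * (c * ∑ q, s q)) / (c * ((∑ y, s (p.1, y)) * (c * ∑ x, s (x, p.2)))) =
      s p * (∑ q, s q) / ((∑ y, s (p.1, y)) * (∑ x, s (x, p.2))) := by
    rw [mul_div_mul_left _ _ hc.ne', mul_left_comm, mul_left_comm _ c, mul_div_mul_left _ _ hc.ne']
  rw [h1, mul_div_mul_left _ _ hc.ne']

lemma sum_exp_eq_exp_neg_OmegaQ {X Y U : Type*} [Fintype X] [Fintype Y] [Fintype U]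
    (π : X × Y → ℝ) (α θ : ℝ) {Q : X × Y × U → ℝ} (hQ : IsPMF Q) :
    ∑ z ∈ Finset.univ.filter (fun z : X × Y × U => 0 < Q z),
      Q z * Real.exp (-(θ * omegaFn π α Q z)) = Real.exp (-OmegaQ π α θ Q) := by
  rw [OmegaQ, neg_neg, Real.exp_log]
  refine Finset.sum_pos (fun z hz => mul_pos (Finset.mem_filter.1 hz).2 (Real.exp_pos _)) ?_
  by_contra h
  rw [Finset.not_nonempty_iff_eq_empty, Finset.filter_eq_empty_iff] at h
  have : ∑ z, Q z ≤ 0 := Finset.sum_nonpos fun z _ => not_lt.1 (h (Finset.mem_univ z))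
  linarith [hQ.2]

/-- Cardinality reduction: an auxiliary alphabet of size `|X||Y|` suffices to minimise `Ω`. -/
lemma le_OmegaQ_of_le_QClass {X Y U : Type*} [Fintype X] [Fintype Y] [Fintype U]
    {π : X × Y → ℝ} {α θ ω : ℝ} (hω : ∀ Q ∈ QClass π, ω ≤ OmegaQ π α θ Q)
    {Q : X × Y × U → ℝ} (hQ : IsPMF Q) (hsupp : ∀ x y u, 0 < Q (x, y, u) → 0 < π (x, y)) :
    ω ≤ OmegaQ π α θ Q := by
  classical
  set m : X × Y → ℝ := fun p => margXY Q p.1 p.2 with hm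
  obtain ⟨c, hc, hcsum, hcobj, hcard⟩ := exists_small_support_combination
    (fun u (p : X × Y) => Q (p.1, p.2, u)) (fun u p => hQ.1 _)
    (fun u => sliceMoment π α θ m (fun p => Q (p.1, p.2, u)))
    (fun u hu => by simp only [hu]; exact sliceMoment_zero π α θ m)
  set S : Finset U := Finset.univ.filter (fun u => c u ≠ 0) with hS
  obtain ⟨e⟩ : Nonempty (S ↪ Fin (Fintype.card X * Fintype.card Y)) :=
    Function.Embedding.nonempty_of_card_le (by simpa [Fintype.card_prod] using hcard)
  set F : Fin (Fintype.card X * Fintype.card Y) → X × Y → ℝ :=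
    Function.extend e (fun u => c u.1 • fun p : X × Y => Q (p.1, p.2, u.1)) 0 with hF
  have hFsum : ∀ φ : (X × Y → ℝ) → ℝ, φ 0 = 0 →
      ∑ j, φ (F j) = ∑ u, φ (c u • fun p : X × Y => Q (p.1, p.2, u)) := by
    intro φ hφ
    rw [← Finset.sum_filter_of_ne (s := Finset.univ) (p := fun u => c u ≠ 0)
      (f := fun u => φ (c u • fun p : X × Y => Q (p.1, p.2, u)))
      (fun u _ hu hcu => hu (by simp [hcu, hφ])), ← hS, ← Finset.sum_coe_sort S]
    symm
    refine Finset.sum_of_injOn e e.injective.injOn (by simp) (fun j _ hj => ?_) (fun u _ => ?_)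
    · rw [hF, Function.extend_apply', Pi.zero_apply, hφ]
      rintro ⟨u, rfl⟩
      exact hj ⟨u, by simp, rfl⟩
    · rw [hF, e.injective.extend_apply]
  have hFnn : ∀ j p, 0 ≤ F j p := by
    intro j p
    by_cases hj : ∃ u, e u = j
    · obtain ⟨u, rfl⟩ := hj
      rw [hF, e.injective.extend_apply]
      exact mul_nonneg (hc _) (hQ.1 _)
    · rw [hF, Function.extend_apply' _ _ _ hj]; rfl
  have hFm : ∀ p, ∑ j, F j p = m p := fun p => by
    rw [hFsum (fun s => s p) rfl]
    exact hcsum p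
  set Q' : X × Y × Fin (Fintype.card X * Fintype.card Y) → ℝ :=
    fun z => F z.2.2 (z.1, z.2.1) with hQ'
  have hmarg : (fun p : X × Y => margXY Q' p.1 p.2) = m := funext fun p => hFm p
  have hQ'pmf : IsPMF Q' := by
    refine ⟨fun z => hFnn _ _, ?_⟩
    rw [← hQ.2]
    simp only [Fintype.sum_prod_type]
    exact Finset.sum_congr rfl fun x _ => Finset.sum_congr rfl fun y _ => hFm (x, y)
  have hmem : Q' ∈ QClass π := by
    refine ⟨hQ'pmf, fun x y hxy => ?_⟩
    have h1 : 0 < ∑ u, Q (x, y, u) := by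
      have := congrFun hmarg (x, y)
      dsimp only at this
      rw [this] at hxy
      exact hxy
    obtain ⟨u, -, hu⟩ := Finset.exists_lt_of_sum_lt (s := Finset.univ)
      (f := fun _ : U => (0 : ℝ)) (by simpa using h1)
    exact hsupp x y u hu
  refine (hω Q' hmem).trans ?_
  rw [← neg_le_neg_iff, ← Real.exp_le_exp, ← sum_exp_eq_exp_neg_OmegaQ π α θ hQ,
    ← sum_exp_eq_exp_neg_OmegaQ π α θ hQ'pmf, sum_exp_eq_sum_sliceMoment,
    sum_exp_eq_sum_sliceMoment, hmarg, hFsum _ (sliceMoment_zero π α θ m)]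
  simpa only [sliceMoment_smul π α θ m (hc _)] using hcobj

lemma sum_fin_succ_fun {X : Type*} [Fintype X] {n : ℕ} (f : (Fin (n + 1) → X) → ℝ) :
    ∑ x, f x = ∑ a, ∑ x : Fin n → X, f (Fin.cons a x) := by
  rw [← Fintype.sum_prod_type' (f := fun a (x : Fin n → X) => f (Fin.cons a x))]
  exact (Fintype.sum_equiv (Fin.consEquiv fun _ => X) _ _ fun p => rfl).symm

/-- Splitting off the first letter from a double sum over sequences. -/
lemma sum_sum_fin_succ {X Y : Type*} [Fintype X] [Fintype Y] {n : ℕ}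
    (f : (Fin (n + 1) → X) → (Fin (n + 1) → Y) → ℝ) :
    ∑ x, ∑ y, f x y = ∑ a, ∑ b, ∑ x : Fin n → X, ∑ y : Fin n → Y,
      f (Fin.cons a x) (Fin.cons b y) := by
  rw [sum_fin_succ_fun]
  refine Finset.sum_congr rfl fun a _ => ?_
  simp only [sum_fin_succ_fun (X := Y)]
  rw [Finset.sum_comm]

lemma sum_div_conditional_le {X Y : Type*} [Fintype X] [Fintype Y] {S D : X → Y → ℝ}
    {p : X → ℝ} (hS : ∀ a b, 0 ≤ S a b) (hp : ∀ a, 0 ≤ p a) (hD : ∀ a b, D a b ≤ S a b * p a) :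
    ∑ a, ∑ b, D a b / ((∑ b', S a b') / ∑ a', ∑ b', S a' b') ≤ (∑ a, ∑ b, S a b) * ∑ a, p a := by
  rw [Finset.mul_sum]
  refine Finset.sum_le_sum fun a _ => ?_
  have h1 : 0 ≤ ∑ b, S a b := Finset.sum_nonneg fun b _ => hS a b
  have h2 : 0 ≤ ∑ a, ∑ b, S a b := Finset.sum_nonneg fun a _ => Finset.sum_nonneg fun b _ => hS a b
  rw [← Finset.sum_div]
  rcases h1.eq_or_lt with h0 | h0
  · rw [← h0]
    simpa using mul_nonneg h2 (hp a)
  calc (∑ b, D a b) / ((∑ b', S a b') / ∑ a', ∑ b', S a' b')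
      ≤ ((∑ b, S a b) * p a) / ((∑ b', S a b') / ∑ a', ∑ b', S a' b') := by
        refine div_le_div_of_nonneg_right ?_ (div_nonneg h1 h2)
        rw [Finset.sum_mul]
        exact Finset.sum_le_sum fun b _ => hD a b
    _ = (∑ a, ∑ b, S a b) * p a := by
        rw [div_div_eq_mul_div, mul_assoc, mul_div_cancel_left₀ _ h0.ne', mul_comm]

universe uX uY

/-- Single-letterization by recursive tilting. For a measure `T` on `V × Xⁿ × Yⁿ` with `XⁿYⁿ`-part
supported in `supp π^{⊗n}` there are a distribution `B` dominating the product of the tilted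
single-letter marginals, causal conditional products `Cx`, `Cy`, and a total information density
`W` whose exponential moment is controlled by `Ω`. -/
lemma exists_single_letterization {X : Type uX} {Y : Type uY} [Fintype X] [Fintype Y]
    {π : X × Y → ℝ} {α θ ω : ℝ} (hω : ∀ Q ∈ QClass π, ω ≤ OmegaQ π α θ Q) (n : ℕ) :
    ∀ {V : Type (max uX uY)} [Fintype V] (T : V → (Fin n → X) → (Fin n → Y) → ℝ) (g : V → ℝ),
    (∀ v, 0 < g v) → (∀ v x y, 0 ≤ T v x y) → (0 < ∑ v, ∑ x, ∑ y, T v x y) →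
    (∀ v x y, 0 < T v x y → ∀ i, 0 < π (x i, y i)) →
    ∃ (B : (Fin n → X) → (Fin n → Y) → ℝ) (Cx Cy W : V → (Fin n → X) → (Fin n → Y) → ℝ),
      (∀ x y, 0 ≤ B x y) ∧ (∑ x, ∑ y, B x y ≤ 1) ∧ (∀ v x y, 0 ≤ Cx v x y) ∧
      (∀ v x y, 0 ≤ Cy v x y) ∧
      (∀ v x y, 0 < T v x y → 0 < B x y ∧ 0 < Cx v x y ∧ 0 < Cy v x y ∧
        W v x y = (1 - α) * (Real.log (B x y / prodDist π n (x, y)) +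
          Real.log (T v x y / ((∑ x', ∑ y', T v x' y') * (Cx v x y * Cy v x y)))) +
          α * Real.log (T v x y / ((∑ x', ∑ y', T v x' y') * prodDist π n (x, y)))) ∧
      (∀ v (p : (Fin n → X) → ℝ), (∀ x, 0 ≤ p x) →
        ∑ x, ∑ y, T v x y * (p x / Cx v x y) ≤ (∑ x, ∑ y, T v x y) * ∑ x, p x) ∧
      (∀ v (q : (Fin n → Y) → ℝ), (∀ y, 0 ≤ q y) →
        ∑ x, ∑ y, T v x y * (q y / Cy v x y) ≤ (∑ x, ∑ y, T v x y) * ∑ y, q y) ∧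
      ∑ v, ∑ x, ∑ y, g v * T v x y * Real.exp (-(θ * W v x y)) ≤
        Real.exp (-(n * ω)) * ∑ v, g v * ∑ x, ∑ y, T v x y := by
  induction n with
  | zero =>
    intro V _ T g hg hT hTpos hsupp
    refine ⟨fun _ _ => 1, fun _ _ _ => 1, fun _ _ _ => 1, fun _ _ _ => 0, by simp, by simp,
      by simp, by simp, ?_, ?_, ?_, ?_⟩
    · intro v x y h
      have : T v default default ≠ 0 := by
        rw [Subsingleton.elim x default, Subsingleton.elim y default] at h
        exact h.ne'
      simp [prodDist, Subsingleton.elim x default, Subsingleton.elim y default, this]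
    · intro v p hp; simp
    · intro v p hp; simp
    · simp
  | succ n ih =>
    intro V _ T g hg hT hTpos hsupp
    set S : V × X × Y → ℝ := fun w => ∑ x : Fin n → X, ∑ y : Fin n → Y,
      T w.1 (Fin.cons w.2.1 x) (Fin.cons w.2.2 y) with hSdef
    have hS : ∀ w, 0 ≤ S w := fun w =>
      Finset.sum_nonneg fun x _ => Finset.sum_nonneg fun y _ => hT _ _ _
    have hTm : ∀ v, ∑ x, ∑ y, T v x y = ∑ a, ∑ b, S (v, a, b) := fun v => sum_sum_fin_succ _
    have hSsupp : ∀ w : V × X × Y, 0 < S w → 0 < π w.2 := by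
      intro w hw
      by_contra hπ
      refine hw.ne' (Finset.sum_eq_zero fun x _ => Finset.sum_eq_zero fun y _ => ?_)
      refine le_antisymm (not_lt.1 fun h => hπ ?_) (hT _ _ _)
      simpa using hsupp _ _ _ h 0
    set N : ℝ := ∑ v, g v * ∑ x, ∑ y, T v x y with hN
    have hTm0 : ∀ v, 0 ≤ ∑ x, ∑ y, T v x y := fun v =>
      Finset.sum_nonneg fun x _ => Finset.sum_nonneg fun y _ => hT _ _ _
    have hNpos : 0 < N := by
      refine lt_of_le_of_ne (Finset.sum_nonneg fun v _ => mul_nonneg (hg v).le (hTm0 v)) fun h => ?_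
      refine hTpos.ne' (Finset.sum_eq_zero fun v _ => ?_)
      have := (Finset.sum_eq_zero_iff_of_nonneg
        (fun v _ => mul_nonneg (hg v).le (hTm0 v))).1 h.symm v (Finset.mem_univ _)
      exact (mul_eq_zero.1 this).resolve_left (hg v).ne'
    set Q : X × Y × V → ℝ := fun z => g z.2.2 * S (z.2.2, z.1, z.2.1) / N with hQdef
    have hQpmf : IsPMF Q := by
      refine ⟨fun z => div_nonneg (mul_nonneg (hg _).le (hS _)) hNpos.le, ?_⟩
      rw [hQdef, ← Finset.sum_div, div_eq_one_iff_eq hNpos.ne', hN]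
      simp only [hTm, Finset.mul_sum]
      simp only [← Fintype.sum_prod_type']
      exact Fintype.sum_equiv ((Equiv.prodAssoc X Y V).symm.trans (Equiv.prodComm _ _)) _ _
        fun z => rfl
    have hQsupp : ∀ x y v, 0 < Q (x, y, v) → 0 < π (x, y) := by
      intro x y v h
      refine hSsupp (v, x, y) (lt_of_le_of_ne (hS _) fun h0 => h.ne' ?_)
      simp [hQdef, ← h0]
    have hΩ : ω ≤ OmegaQ π α θ Q := le_OmegaQ_of_le_QClass hω hQpmf hQsupp
    obtain ⟨B, Cx, Cy, W, hB, hB1, hCx, hCy, hpos, hx, hy, hW⟩ :=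
      ih (V := V × X × Y) (fun w x y => T w.1 (Fin.cons w.2.1 x) (Fin.cons w.2.2 y))
        (fun w => g w.1 * Real.exp (-(θ * omegaFn π α Q (w.2.1, w.2.2, w.1))))
        (fun w => mul_pos (hg _) (Real.exp_pos _)) (fun w x y => hT _ _ _)
        (by
          simp only [Fintype.sum_prod_type]
          simpa only [sum_sum_fin_succ] using hTpos)
        (fun w x y h i => by simpa using hsupp _ _ _ h i.succ)
    refine ⟨fun x y => margXY Q (x 0) (y 0) * B (Fin.tail x) (Fin.tail y),
      fun v x y => (∑ b, S (v, x 0, b)) / (∑ a, ∑ b, S (v, a, b)) *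
        Cx (v, x 0, y 0) (Fin.tail x) (Fin.tail y),
      fun v x y => (∑ a, S (v, a, y 0)) / (∑ a, ∑ b, S (v, a, b)) *
        Cy (v, x 0, y 0) (Fin.tail x) (Fin.tail y),
      fun v x y => omegaFn π α Q (x 0, y 0, v) + W (v, x 0, y 0) (Fin.tail x) (Fin.tail y),
      ?_, ?_, ?_, ?_, ?_, ?_, ?_, ?_⟩
    · exact fun x y => mul_nonneg (Finset.sum_nonneg fun u _ => hQpmf.1 _) (hB _ _)
    · rw [sum_sum_fin_succ]
      simp only [Fin.cons_zero, Fin.tail_cons, ← Finset.mul_sum]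
      calc ∑ a, ∑ b, margXY Q a b * ∑ x, ∑ y, B x y
          ≤ ∑ a, ∑ b, margXY Q a b * 1 := by
            gcongr with a _ b _
            exact Finset.sum_nonneg fun u _ => hQpmf.1 _
        _ = ∑ z, Q z := by simp [margXY, Fintype.sum_prod_type]
        _ ≤ 1 := hQpmf.2.le
    · exact fun v x y => mul_nonneg (div_nonneg (Finset.sum_nonneg fun _ _ => hS _)
        (Finset.sum_nonneg fun _ _ => Finset.sum_nonneg fun _ _ => hS _)) (hCx _ _ _)
    · exact fun v x y => mul_nonneg (div_nonneg (Finset.sum_nonneg fun _ _ => hS _)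
        (Finset.sum_nonneg fun _ _ => Finset.sum_nonneg fun _ _ => hS _)) (hCy _ _ _)
    · intro v x y h
      obtain ⟨a, x, rfl⟩ : ∃ a x', x = Fin.cons a x' := ⟨x 0, Fin.tail x, (Fin.cons_self_tail x).symm⟩
      obtain ⟨b, y, rfl⟩ : ∃ b y', y = Fin.cons b y' := ⟨y 0, Fin.tail y, (Fin.cons_self_tail y).symm⟩
      simp only [Fin.cons_zero, Fin.tail_cons]
      obtain ⟨h1, h2, h3, h4⟩ := hpos (v, a, b) x y h
      have hg0 := (hg v).ne'
      have hN0 := hNpos.ne'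
      have hs : 0 < S (v, a, b) := h.trans_le
        ((Finset.single_le_sum (f := fun y => T v (Fin.cons a x) (Fin.cons b y))
          (fun y _ => hT _ _ _) (Finset.mem_univ y)).trans
        (Finset.single_le_sum (f := fun x => ∑ y, T v (Fin.cons a x) (Fin.cons b y))
          (fun x _ => Finset.sum_nonneg fun y _ => hT _ _ _) (Finset.mem_univ x)))
      have hsx : 0 < ∑ b, S (v, a, b) := hs.trans_le
        (Finset.single_le_sum (f := fun b => S (v, a, b)) (fun _ _ => hS _) (Finset.mem_univ b))
      have hsy : 0 < ∑ a, S (v, a, b) := hs.trans_le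
        (Finset.single_le_sum (f := fun a => S (v, a, b)) (fun _ _ => hS _) (Finset.mem_univ a))
      have hsm : 0 < ∑ a, ∑ b, S (v, a, b) := hsx.trans_le
        (Finset.single_le_sum (f := fun a => ∑ b, S (v, a, b))
          (fun _ _ => Finset.sum_nonneg fun _ _ => hS _) (Finset.mem_univ a))
      have hq : 0 < margXY Q a b := (div_pos (mul_pos (hg v) hs) hNpos).trans_le
        (Finset.single_le_sum (f := fun u => Q (a, b, u)) (fun _ _ => hQpmf.1 _)
          (Finset.mem_univ v))
      have hπ0 : 0 < π (a, b) := hSsupp _ hs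
      have hπn : 0 < prodDist π n (x, y) := Finset.prod_pos fun i _ => by
        simpa using hsupp _ _ _ h i.succ
      have hprod : prodDist π (n + 1) (Fin.cons a x, Fin.cons b y) =
          π (a, b) * prodDist π n (x, y) := by
        simp [prodDist, Fin.prod_univ_succ]
      have hU : margU Q v = g v * (∑ a, ∑ b, S (v, a, b)) / N := by
        simp only [margU, hQdef, Fintype.sum_prod_type, Finset.mul_sum, Finset.sum_div]
      have hXU : margXU Q a v = g v * (∑ b, S (v, a, b)) / N := by
        simp only [margXU, hQdef, Finset.mul_sum, Finset.sum_div]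
      have hYU : margYU Q b v = g v * (∑ a, S (v, a, b)) / N := by
        simp only [margYU, hQdef, Finset.mul_sum, Finset.sum_div]
      refine ⟨mul_pos hq h1, mul_pos (div_pos hsx hsm) h2, mul_pos (div_pos hsy hsm) h3, ?_⟩
      rw [h4, hTm, hprod, omegaFn]
      dsimp only
      rw [hU, hXU, hYU]
      rw [show (∑ x', ∑ y', T v (Fin.cons a x') (Fin.cons b y')) = S (v, a, b) from rfl]
      have hQv : Q (a, b, v) = g v * S (v, a, b) / N := rfl
      rw [hQv]
      generalize T v (Fin.cons a x) (Fin.cons b y) = t at *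
      generalize S (v, a, b) = s at *
      generalize ∑ a, ∑ b, S (v, a, b) = sm at *
      generalize ∑ b, S (v, a, b) = sx at *
      generalize ∑ a, S (v, a, b) = sy at *
      have e1 : Real.log (margXY Q a b * B x y / (π (a, b) * prodDist π n (x, y))) =
          Real.log (margXY Q a b / π (a, b)) + Real.log (B x y / prodDist π n (x, y)) := by
        rw [← Real.log_mul (by positivity) (by positivity), div_mul_div_comm]
      have e2 : Real.log (t / (sm * (sx / sm * Cx (v, a, b) x y * (sy / sm * Cy (v, a, b) x y)))) =
          Real.log (g v * s / N * (g v * sm / N) / (g v * sx / N * (g v * sy / N))) +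
          Real.log (t / (s * (Cx (v, a, b) x y * Cy (v, a, b) x y))) := by
        have := hg v
        rw [← Real.log_mul (by positivity) (by positivity)]
        congr 1
        field_simp
      have e3 : Real.log (t / (sm * (π (a, b) * prodDist π n (x, y)))) =
          Real.log (g v * s / N / (g v * sm / N * π (a, b))) +
          Real.log (t / (s * prodDist π n (x, y))) := by
        have := hg v
        rw [← Real.log_mul (by positivity) (by positivity)]
        congr 1
        field_simp
      rw [e1, e2, e3]
      ring
    · intro v p hp
      rw [sum_sum_fin_succ, hTm, sum_fin_succ_fun]
      refine le_trans (le_of_eq ?_) (sum_div_conditional_le (S := fun a b => S (v, a, b))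
        (D := fun a b => ∑ x, ∑ y, T v (Fin.cons a x) (Fin.cons b y) *
          (p (Fin.cons a x) / Cx (v, a, b) x y)) (fun a b => hS _)
        (fun a => Finset.sum_nonneg fun x _ => hp (Fin.cons a x))
        fun a b => hx (v, a, b) (fun x => p (Fin.cons a x)) fun x => hp _)
      simp only [Fin.cons_zero, Fin.tail_cons]
      refine Finset.sum_congr rfl fun a _ => Finset.sum_congr rfl fun b _ => ?_
      simp only [div_eq_mul_inv _ (_ / _), Finset.sum_mul]
      refine Finset.sum_congr rfl fun x _ => Finset.sum_congr rfl fun y _ => ?_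
      rw [← div_eq_mul_inv, mul_div_assoc, div_div, mul_comm (Cx _ _ _)]
    · intro v q hq
      rw [sum_sum_fin_succ, hTm, sum_fin_succ_fun, Finset.sum_comm]
      have := (sum_div_conditional_le (S := fun b a => S (v, a, b))
        (D := fun b a => ∑ x, ∑ y, T v (Fin.cons a x) (Fin.cons b y) *
          (q (Fin.cons b y) / Cy (v, a, b) x y)) (fun a b => hS _)
        (fun b => Finset.sum_nonneg fun y _ => hq (Fin.cons b y))
        fun b a => hy (v, a, b) (fun y => q (Fin.cons b y)) fun y => hq _)
      rw [Finset.sum_comm (f := fun b a => S (v, a, b))] at this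
      refine le_trans (le_of_eq ?_) this
      simp only [Fin.cons_zero, Fin.tail_cons]
      refine Finset.sum_congr rfl fun a _ => Finset.sum_congr rfl fun b _ => ?_
      simp only [div_eq_mul_inv _ (_ / _), Finset.sum_mul]
      refine Finset.sum_congr rfl fun x _ => Finset.sum_congr rfl fun y _ => ?_
      rw [← div_eq_mul_inv, mul_div_assoc, div_div, mul_comm (Cy _ _ _)]
    · have hsum : ∑ w : V × X × Y, g w.1 * Real.exp (-(θ * omegaFn π α Q (w.2.1, w.2.2, w.1))) *
          S w = N * Real.exp (-OmegaQ π α θ Q) := by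
        rw [← sum_exp_eq_exp_neg_OmegaQ π α θ hQpmf, Finset.sum_filter_of_ne, Finset.mul_sum]
        · refine Fintype.sum_equiv ((Equiv.prodComm _ _).trans (Equiv.prodAssoc X Y V)) _ _
            fun w => ?_
          simp only [hQdef, Equiv.trans_apply, Equiv.prodComm_apply, Prod.swap, Equiv.prodAssoc_apply]
          field_simp
        · exact fun z _ hz => lt_of_le_of_ne (hQpmf.1 z) fun h => hz (by simp [← h])
      calc _ = ∑ w : V × X × Y, ∑ x, ∑ y,
            g w.1 * Real.exp (-(θ * omegaFn π α Q (w.2.1, w.2.2, w.1))) *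
            T w.1 (Fin.cons w.2.1 x) (Fin.cons w.2.2 y) * Real.exp (-(θ * W w x y)) := by
            simp only [sum_sum_fin_succ, Fintype.sum_prod_type, Fin.cons_zero, Fin.tail_cons,
              mul_add, neg_add, Real.exp_add]
            refine Finset.sum_congr rfl fun v _ => Finset.sum_congr rfl fun a _ =>
              Finset.sum_congr rfl fun b _ => Finset.sum_congr rfl fun x _ =>
              Finset.sum_congr rfl fun y _ => ?_
            ring
        _ ≤ Real.exp (-(n * ω)) * (N * Real.exp (-OmegaQ π α θ Q)) := hsum ▸ hW
        _ ≤ Real.exp (-(n * ω)) * (N * Real.exp (-ω)) := by gcongr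
        _ = Real.exp (-((n + 1 : ℕ) * ω)) * N := by
            rw [mul_left_comm, mul_comm N, ← Real.exp_add]
            congr 2
            push_cast
            ring

lemma tvDist_eq_one_sub_sum_min {A : Type*} [Fintype A] {P Q : A → ℝ} (hP : IsPMF P)
    (hQ : IsPMF Q) : tvDist P Q = 1 - ∑ a, min (P a) (Q a) := by
  have h : ∀ a, |P a - Q a| = P a + Q a - 2 * min (P a) (Q a) := fun a => by
    rcases le_total (P a) (Q a) with h | h
    · rw [min_eq_left h, abs_of_nonpos (by linarith)]; ring
    · rw [min_eq_right h, abs_of_nonneg (by linarith)]; ring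
  simp only [tvDist, h, Finset.sum_sub_distrib, Finset.sum_add_distrib, ← Finset.mul_sum, hP.2, hQ.2]
  ring

lemma IsPMF.prodDist {X Y : Type*} [Fintype X] [Fintype Y] {π : X × Y → ℝ} (hπ : IsPMF π)
    (n : ℕ) : IsPMF (prodDist π n) := by
  classical
  refine ⟨fun z => Finset.prod_nonneg fun i _ => hπ.1 _, ?_⟩
  calc ∑ z, _root_.prodDist π n z = ∑ z : Fin n → X × Y, ∏ i, π (z i) :=
        (Fintype.sum_equiv (Equiv.arrowProdEquivProdArrow (Fin n) (fun _ => X) (fun _ => Y)) _ _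
          fun z => rfl).symm
    _ = 1 := by
        rw [← Fintype.piFinset_univ, ← Finset.prod_univ_sum]
        simp [hπ.2]

lemma SynthCode.isPMF_induced {X Y : Type*} [Fintype X] [Fintype Y] {M n : ℕ} (hM : 0 < M)
    (c : SynthCode X Y M n) : IsPMF c.induced := by
  refine ⟨fun z => mul_nonneg (by positivity) (Finset.sum_nonneg fun m _ =>
    mul_nonneg ((c.PX_pmf m).1 _) ((c.PY_pmf m).1 _)), ?_⟩
  simp only [SynthCode.induced]
  rw [← Finset.mul_sum, Finset.sum_comm]
  simp [Fintype.sum_prod_type, ← Finset.mul_sum, (c.PX_pmf _).2, (c.PY_pmf _).2, hM.ne']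

/-- Weighted convexity of `exp`, applied to the total information density `w` and the logarithms
`l₁, …, l₄` of the change-of-measure ratios. -/
lemma min_one_exp_le {α θ s w l₁ l₂ l₃ l₄ ρ ℓ r : ℝ} (hα1 : α ≤ 1) (hθ : 0 ≤ θ)
    (hs0 : 0 ≤ s) (hs : s * (1 + (5 - 3 * α) * θ) = 1)
    (hw : w ≤ (1 - α) * (l₁ - ρ + l₂ + l₃ + l₄) + α * (r + l₂)) :
    min 1 (Real.exp ρ) ≤ (s * Real.exp (-(θ * w) - ℓ) + s * θ * (1 - α) * Real.exp l₁ +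
      s * θ * Real.exp l₂ + s * θ * (1 - α) * Real.exp l₃ + s * θ * (1 - α) * Real.exp l₄ +
      s * θ) * Real.exp (s * (ℓ + θ * α * r)) := by
  have hα : 0 ≤ 1 - α := by linarith
  have hsθ : 0 ≤ s * θ := mul_nonneg hs0 hθ
  have hk0 : 0 ≤ s * θ * (1 - α) := mul_nonneg hsθ hα
  have hk1 : s * θ * (1 - α) ≤ 1 := by nlinarith [mul_nonneg hsθ hα]
  have hconv := convexOn_exp.map_sum_le (t := Finset.univ)
    (w := ![s, s * θ * (1 - α), s * θ, s * θ * (1 - α), s * θ * (1 - α), s * θ])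
    (p := ![-(θ * w) - ℓ, l₁, l₂, l₃, l₄, 0])
    (by intro i _; fin_cases i <;> simp <;> assumption)
    (by simp [Fin.sum_univ_six]; linarith) (by simp)
  simp only [Fin.sum_univ_six, smul_eq_mul, Matrix.cons_val, Real.exp_zero, mul_one, mul_zero,
    add_zero] at hconv
  have hmin : min 1 (Real.exp ρ) ≤ Real.exp (s * θ * (1 - α) * ρ) := by
    rcases le_total 0 ρ with h | h
    · exact (min_le_left _ _).trans (Real.one_le_exp (mul_nonneg hk0 h))
    · exact (min_le_right _ _).trans (Real.exp_le_exp.2 (by nlinarith))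
  refine hmin.trans (le_trans ?_ (mul_le_mul_of_nonneg_right hconv (Real.exp_pos _).le))
  rw [← Real.exp_add, Real.exp_le_exp]
  nlinarith [mul_le_mul_of_nonneg_left hw hsθ]

/-- The overlap of a code-induced distribution with `π^{⊗n}` decays exponentially. -/
lemma sum_min_le_exp {X : Type uX} {Y : Type uY} [Fintype X] [Fintype Y] {π : X × Y → ℝ}
    (hπ : IsPMF π) {α θ ω s r : ℝ} (hα0 : 0 ≤ α) (hα1 : α ≤ 1) (hθ : 0 ≤ θ) (hs0 : 0 ≤ s)
    (hs : s * (1 + (5 - 3 * α) * θ) = 1) (hω : ∀ Q ∈ QClass π, ω ≤ OmegaQ π α θ Q) {n : ℕ}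
    {V : Type (max uX uY)} [Fintype V] [Nonempty V] (hr : Real.log (Fintype.card V) ≤ r)
    {p : V → (Fin n → X) → ℝ} {q : V → (Fin n → Y) → ℝ}
    (hp : ∀ v, IsPMF (p v)) (hq : ∀ v, IsPMF (q v)) :
    ∑ x, ∑ y, min ((Fintype.card V : ℝ)⁻¹ * ∑ v, p v x * q v y) (prodDist π n (x, y)) ≤
      Real.exp (s * (-(n * ω) + θ * α * r)) := by
  classical
  set k : ℝ := (Fintype.card V : ℝ) with hk
  have hk0 : 0 < k := by rw [hk]; exact_mod_cast Fintype.card_pos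
  set P : (Fin n → X) → (Fin n → Y) → ℝ := fun x y => k⁻¹ * ∑ v, p v x * q v y with hPdef
  have hpq : ∀ v x y, 0 ≤ p v x * q v y := fun v x y => mul_nonneg ((hp v).1 x) ((hq v).1 y)
  have hP : ∀ x y, 0 ≤ P x y := fun x y =>
    mul_nonneg (inv_nonneg.2 hk0.le) (Finset.sum_nonneg fun v _ => hpq v x y)
  have hD := (hπ.prodDist n).1
  have hD1 : ∑ x, ∑ y, prodDist π n (x, y) = 1 := by
    rw [← (hπ.prodDist n).2, Fintype.sum_prod_type]
  set T : V → (Fin n → X) → (Fin n → Y) → ℝ := fun v x y =>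
    if P x y = 0 then prodDist π n (x, y) / k
    else prodDist π n (x, y) * (k⁻¹ * (p v x * q v y)) / P x y with hTdef
  have hT : ∀ v x y, 0 ≤ T v x y := by
    intro v x y
    simp only [hTdef]
    split_ifs
    · exact div_nonneg (hD _) hk0.le
    · exact div_nonneg (mul_nonneg (hD _) (mul_nonneg (inv_nonneg.2 hk0.le) (hpq _ _ _))) (hP _ _)
  have hTsum : ∀ x y, ∑ v, T v x y = prodDist π n (x, y) := by
    intro x y
    simp only [hTdef]
    split_ifs with h
    · rw [Finset.sum_const, Finset.card_univ, nsmul_eq_mul, ← hk, mul_div_cancel₀ _ hk0.ne']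
    · rw [← Finset.sum_div, ← Finset.mul_sum, ← Finset.mul_sum, mul_div_assoc]
      exact (congrArg _ (div_self h)).trans (mul_one _)
  have hcomm : ∀ f : V → (Fin n → X) → (Fin n → Y) → ℝ,
      ∑ v, ∑ x, ∑ y, f v x y = ∑ x, ∑ y, ∑ v, f v x y := fun f => by
    rw [Finset.sum_comm]
    exact Finset.sum_congr rfl fun x _ => Finset.sum_comm
  have hTD : ∀ v x y, 0 < T v x y → 0 < prodDist π n (x, y) := fun v x y h =>
    h.trans_le ((Finset.single_le_sum (f := fun v => T v x y) (fun _ _ => hT _ _ _)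
      (Finset.mem_univ v)).trans (hTsum x y).le)
  have hT1 : ∑ v, ∑ x, ∑ y, T v x y = 1 := by
    rw [hcomm]
    simp only [hTsum, hD1]
  set τ : V → ℝ := fun v => ∑ x, ∑ y, T v x y with hτ
  have hτ0 : ∀ v, 0 ≤ τ v := fun v =>
    Finset.sum_nonneg fun x _ => Finset.sum_nonneg fun y _ => hT _ _ _
  obtain ⟨B, Cx, Cy, W, hB, hB1, hCx, hCy, hpos, hx, hy, hW⟩ :=
    exists_single_letterization hω n T (fun _ => 1) (fun _ => one_pos) hT (hT1.symm ▸ one_pos)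
      (fun v x y h i => lt_of_le_of_ne (hπ.1 _)
        (Finset.prod_ne_zero_iff.1 (hTD v x y h).ne' i (Finset.mem_univ i)).symm)
  have hsθ : 0 ≤ s * θ := mul_nonneg hs0 hθ
  have hk' : 0 ≤ s * θ * (1 - α) := mul_nonneg hsθ (by linarith)
  have hpoint : ∀ v x y, T v x y * min 1 (P x y / prodDist π n (x, y)) ≤ T v x y *
      (s * (Real.exp (-(θ * W v x y)) * Real.exp (n * ω)) +
        s * θ * (1 - α) * (B x y / prodDist π n (x, y)) + s * θ * (k⁻¹ / τ v) +
        s * θ * (1 - α) * (p v x / Cx v x y) + s * θ * (1 - α) * (q v y / Cy v x y) + s * θ) *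
      Real.exp (s * (-(n * ω) + θ * α * r)) := by
    intro v x y
    rw [mul_assoc]
    rcases (hT v x y).eq_or_lt with ht | ht
    · rw [← ht, zero_mul, zero_mul]
    refine mul_le_mul_of_nonneg_left ?_ ht.le
    have hd := hTD v x y ht
    obtain ⟨hb, hcx, hcy, hw⟩ := hpos v x y ht
    have hτv : 0 < τ v := ht.trans_le
      ((Finset.single_le_sum (f := fun y => T v x y) (fun _ _ => hT _ _ _)
        (Finset.mem_univ y)).trans
      (Finset.single_le_sum (f := fun x => ∑ y, T v x y)
        (fun x _ => Finset.sum_nonneg fun y _ => hT _ _ _) (Finset.mem_univ x)))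
    rcases (hP x y).eq_or_lt with hP0 | hP0
    · have := (hp v).1 x
      have := (hq v).1 y
      rw [← hP0, zero_div, min_eq_right zero_le_one]
      positivity
    have hTeq : T v x y = prodDist π n (x, y) * (k⁻¹ * (p v x * q v y)) / P x y := if_neg hP0.ne'
    have hpq0 : p v x * q v y ≠ 0 := fun h0 => ht.ne' (by rw [hTeq, h0]; simp)
    have hpv : 0 < p v x := lt_of_le_of_ne ((hp v).1 x) (left_ne_zero_of_mul hpq0).symm
    have hqv : 0 < q v y := lt_of_le_of_ne ((hq v).1 y) (right_ne_zero_of_mul hpq0).symm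
    have key := min_one_exp_le (w := W v x y) (l₁ := Real.log (B x y / prodDist π n (x, y)))
      (l₂ := Real.log (k⁻¹ / τ v)) (l₃ := Real.log (p v x / Cx v x y))
      (l₄ := Real.log (q v y / Cy v x y)) (ρ := Real.log (P x y / prodDist π n (x, y)))
      (ℓ := -(n * ω)) (r := r) hα1 hθ hs0 hs ?_
    · rwa [Real.exp_log (by positivity), Real.exp_log (by positivity),
        Real.exp_log (by positivity), Real.exp_log (by positivity), Real.exp_log (by positivity),
        sub_neg_eq_add, Real.exp_add] at key
    change W v x y = (1 - α) * (_ + Real.log (T v x y / (τ v * _))) +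
      α * Real.log (T v x y / (τ v * _)) at hw
    have e1 : Real.log (T v x y / (τ v * (Cx v x y * Cy v x y))) =
        -Real.log (P x y / prodDist π n (x, y)) + Real.log (k⁻¹ / τ v) +
        Real.log (p v x / Cx v x y) + Real.log (q v y / Cy v x y) := by
      rw [← Real.log_inv, ← Real.log_mul (by positivity) (by positivity),
        ← Real.log_mul (by positivity) (by positivity),
        ← Real.log_mul (by positivity) (by positivity), hTeq]
      congr 1
      field_simp
    have e2 : Real.log (T v x y / (τ v * prodDist π n (x, y))) ≤ r + Real.log (k⁻¹ / τ v) := by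
      have hle : k⁻¹ * (p v x * q v y) ≤ P x y :=
        mul_le_mul_of_nonneg_left (Finset.single_le_sum (f := fun v => p v x * q v y)
          (fun _ _ => hpq _ _ _) (Finset.mem_univ v)) (inv_nonneg.2 hk0.le)
      calc Real.log (T v x y / (τ v * prodDist π n (x, y))) ≤ Real.log (k * (k⁻¹ / τ v)) := by
            refine Real.log_le_log (by positivity) ?_
            rw [div_le_iff₀ (by positivity), hTeq, div_le_iff₀ hP0]
            calc prodDist π n (x, y) * (k⁻¹ * (p v x * q v y)) ≤ prodDist π n (x, y) * P x y := by
                  gcongr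
              _ = k * (k⁻¹ / τ v) * (τ v * prodDist π n (x, y)) * P x y := by
                  field_simp
        _ = Real.log k + Real.log (k⁻¹ / τ v) := Real.log_mul hk0.ne' (by positivity)
        _ ≤ r + Real.log (k⁻¹ / τ v) := by gcongr
    rw [hw, e1]
    nlinarith [mul_le_mul_of_nonneg_left e2 hα0]
  have hm1 : ∑ v, ∑ x, ∑ y, T v x y * (Real.exp (-(θ * W v x y)) * Real.exp (n * ω)) ≤ 1 := by
    have hW' : ∑ v, ∑ x, ∑ y, T v x y * Real.exp (-(θ * W v x y)) ≤ Real.exp (-(n * ω)) := by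
      simp only [one_mul] at hW
      exact hW.trans_eq ((congrArg _ hT1).trans (mul_one _))
    simp only [← mul_assoc, ← Finset.sum_mul]
    calc _ ≤ Real.exp (-(n * ω)) * Real.exp (n * ω) :=
          mul_le_mul_of_nonneg_right hW' (Real.exp_pos _).le
      _ = 1 := by rw [← Real.exp_add]; simp
  have hm2 : ∑ v, ∑ x, ∑ y, T v x y * (B x y / prodDist π n (x, y)) ≤ 1 := by
    rw [hcomm]
    simp only [← Finset.sum_mul, hTsum]
    refine le_trans (Finset.sum_le_sum fun x _ => Finset.sum_le_sum fun y _ => ?_) hB1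
    rcases (hD (x, y)).eq_or_lt with h | h
    · rw [← h]; simpa using hB x y
    · rw [mul_div_cancel₀ _ h.ne']
  have hm3 : ∑ v, ∑ x, ∑ y, T v x y * (k⁻¹ / τ v) ≤ 1 := by
    simp only [← Finset.sum_mul]
    calc ∑ v, τ v * (k⁻¹ / τ v) ≤ ∑ v : V, k⁻¹ := Finset.sum_le_sum fun v _ => by
          rcases (hτ0 v).eq_or_lt with h | h
          · rw [← h]; simpa using hk0.le
          · rw [mul_div_cancel₀ _ h.ne']
      _ = 1 := by
          rw [Finset.sum_const, Finset.card_univ, nsmul_eq_mul, ← hk, mul_inv_cancel₀ hk0.ne']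
  have hm4 : ∑ v, ∑ x, ∑ y, T v x y * (p v x / Cx v x y) ≤ 1 := by
    rw [← hT1]
    exact Finset.sum_le_sum fun v _ => (hx v (p v) (hp v).1).trans_eq (by rw [(hp v).2, mul_one])
  have hm5 : ∑ v, ∑ x, ∑ y, T v x y * (q v y / Cy v x y) ≤ 1 := by
    rw [← hT1]
    exact Finset.sum_le_sum fun v _ => (hy v (q v) (hq v).1).trans_eq (by rw [(hq v).2, mul_one])
  calc ∑ x, ∑ y, min (P x y) (prodDist π n (x, y))
      = ∑ v, ∑ x, ∑ y, T v x y * min 1 (P x y / prodDist π n (x, y)) := by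
        rw [hcomm]
        refine Finset.sum_congr rfl fun x _ => Finset.sum_congr rfl fun y _ => ?_
        rw [← Finset.sum_mul, hTsum]
        rcases (hD (x, y)).eq_or_lt with h | h
        · rw [← h]; simp [hP x y]
        · rw [mul_min_of_nonneg _ _ h.le, mul_div_cancel₀ _ h.ne', mul_one, min_comm]
    _ ≤ _ := Finset.sum_le_sum fun v _ => Finset.sum_le_sum fun x _ =>
        Finset.sum_le_sum fun y _ => hpoint v x y
    _ = (s * (∑ v, ∑ x, ∑ y, T v x y * (Real.exp (-(θ * W v x y)) * Real.exp (n * ω))) +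
        s * θ * (1 - α) * (∑ v, ∑ x, ∑ y, T v x y * (B x y / prodDist π n (x, y))) +
        s * θ * (∑ v, ∑ x, ∑ y, T v x y * (k⁻¹ / τ v)) +
        s * θ * (1 - α) * (∑ v, ∑ x, ∑ y, T v x y * (p v x / Cx v x y)) +
        s * θ * (1 - α) * (∑ v, ∑ x, ∑ y, T v x y * (q v y / Cy v x y)) +
        s * θ * ∑ v, ∑ x, ∑ y, T v x y) * Real.exp (s * (-(n * ω) + θ * α * r)) := by
        simp only [Finset.mul_sum, ← Finset.sum_add_distrib, Finset.sum_mul]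
        refine Finset.sum_congr rfl fun v _ => Finset.sum_congr rfl fun x _ =>
          Finset.sum_congr rfl fun y _ => ?_
        ring
    _ ≤ (s * 1 + s * θ * (1 - α) * 1 + s * θ * 1 + s * θ * (1 - α) * 1 + s * θ * (1 - α) * 1 +
        s * θ * 1) * Real.exp (s * (-(n * ω) + θ * α * r)) := by
        rw [hT1]
        gcongr
    _ = Real.exp (s * (-(n * ω) + θ * α * r)) := by
        rw [show s * 1 + s * θ * (1 - α) * 1 + s * θ * 1 + s * θ * (1 - α) * 1 +
          s * θ * (1 - α) * 1 + s * θ * 1 = 1 by linarith, one_mul]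

/-- Non-asymptotic strong converse bound: any synthesis code with
`(1/n) log |ℳ_n| ≤ R` satisfies `|P_{X^nY^n} − π^{⊗n}| ≥ 1 − 4 exp(−n F(R))`. -/
theorem nonasymptotic_strong_converse
    {X Y : Type*} [Fintype X] [Fintype Y] (π : X × Y → ℝ) (hπ : IsPMF π)
    (n M : ℕ) (hn : 0 < n) (hM : 0 < M) (R : ℝ) (hR0 : 0 ≤ R)
    (hrate : (n : ℝ)⁻¹ * Real.log M ≤ R)
    (c : SynthCode X Y M n) :
    1 - 4 * Real.exp (-(n * Fexp π R)) ≤ tvDist c.induced (prodDist π n) := by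
  have htv : tvDist c.induced (prodDist π n) = 1 - ∑ x, ∑ y,
      min (c.induced (x, y)) (prodDist π n (x, y)) := by
    rw [tvDist_eq_one_sub_sum_min (c.isPMF_induced hM) (hπ.prodDist n), Fintype.sum_prod_type]
  set ε : ℝ := ∑ x, ∑ y, min (c.induced (x, y)) (prodDist π n (x, y)) with hε
  have hn' : (0 : ℝ) < n := by exact_mod_cast hn
  have hε1 : ε ≤ 1 := by
    rw [hε, ← (hπ.prodDist n).2, Fintype.sum_prod_type]
    exact Finset.sum_le_sum fun x _ => Finset.sum_le_sum fun y _ => min_le_right _ _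
  have hlogM : Real.log M ≤ n * R := by
    rwa [inv_mul_le_iff₀ hn'] at hrate
  rw [htv, sub_le_sub_iff_left]
  suffices h : ε ≤ Real.exp (-(n * Fexp π R)) by linarith [Real.exp_pos (-(n * Fexp π R))]
  rcases le_or_gt ε 0 with hε0 | hε0
  · exact hε0.trans (Real.exp_pos _).le
  suffices h : Fexp π R ≤ -Real.log ε / n by
    rw [le_div_iff₀ hn'] at h
    rw [← Real.log_le_iff_le_exp hε0]
    linarith
  refine csSup_le ⟨_, 0, by simp, 0, by simp, rfl⟩ ?_
  rintro _ ⟨α, ⟨hα0, hα1⟩, θ, hθ, rfl⟩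
  replace hθ : 0 ≤ θ := hθ
  have hden : 0 < 1 + (5 - 3 * α) * θ := by nlinarith
  by_cases hbdd : BddBelow { r | ∃ Q ∈ QClass π, r = OmegaQ π α θ Q }
  · have hω : ∀ Q ∈ QClass π, OmegaMin π α θ ≤ OmegaQ π α θ Q := fun Q hQ =>
      csInf_le hbdd ⟨Q, hQ, rfl⟩
    have : Nonempty (Fin M) := ⟨⟨0, hM⟩⟩
    have h := sum_min_le_exp hπ hα0 hα1 hθ (inv_nonneg.2 hden.le) (inv_mul_cancel₀ hden.ne') hω
      (V := ULift (Fin M)) (r := n * R) (by simpa using hlogM)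
      (p := fun v => c.PX v.down) (q := fun v => c.PY v.down)
      (fun v => c.PX_pmf _) (fun v => c.PY_pmf _)
    replace h : ε ≤ Real.exp ((1 + (5 - 3 * α) * θ)⁻¹ *
        (-(n * OmegaMin π α θ) + θ * α * (n * R))) := by
      refine (Finset.sum_congr rfl fun x _ => Finset.sum_congr rfl fun y _ => ?_).trans_le h
      rw [Fintype.card_ulift, Fintype.card_fin, SynthCode.induced]
      congr 2
      exact (Fintype.sum_equiv Equiv.ulift _ _ fun v => rfl).symm
    rw [← Real.log_le_iff_le_exp hε0] at h
    rw [le_div_iff₀ hn', Fat]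
    calc _ = -((1 + (5 - 3 * α) * θ)⁻¹ * (-(n * OmegaMin π α θ) + θ * α * (n * R))) := by
          field_simp
          ring
      _ ≤ _ := neg_le_neg h
  · have hzero : OmegaMin π α θ = 0 := Real.sInf_of_not_bddBelow hbdd
    rw [Fat, hzero]
    refine le_trans (div_nonpos_of_nonpos_of_nonneg ?_ hden.le)
      (div_nonneg (neg_nonneg.2 (Real.log_nonpos hε0.le hε1)) hn'.le)
    have := mul_nonneg (mul_nonneg hθ hα0) hR0
    linarith
end
end

section
/- Improved lower bound on Rényi divergence in terms of total variation: for every s ∈ [0,∞), every ε ∈ [0,1], and any probability distributions P, Q on a common finite alphabet with |P−Q| ≥ ε, it holds that D_{1+s}(P‖Q) ≥ [ log( 1/(4(1−ε)) ) ]⁺, where [x]⁺ := max{x,0} (and the right side is interpreted as +∞ when ε = 1). -/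
noncomputable section

/-- Jensen's inequality for the logarithm. -/
theorem sum_mul_log_le_log_sum {ι : Type*} (t : Finset ι) (w x : ι → ℝ)
    (hw : ∀ i ∈ t, 0 ≤ w i) (hw1 : ∑ i ∈ t, w i = 1) (hx : ∀ i ∈ t, 0 < x i) :
    ∑ i ∈ t, w i * Real.log (x i) ≤ Real.log (∑ i ∈ t, w i * x i) := by
  have h := strictConcaveOn_log_Ioi.concaveOn.le_map_sum hw hw1 (p := x)
    (fun i hi => Set.mem_Ioi.mpr (hx i hi))
  simpa only [smul_eq_mul] using h

theorem IsPMF.sum_support {α : Type*} [Fintype α] {P : α → ℝ} (hP : IsPMF P) :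
    ∑ a ∈ Finset.univ.filter (fun a => 0 < P a), P a = 1 := by
  rw [← hP.2]
  refine Finset.sum_subset (Finset.filter_subset _ _) fun a _ ha => ?_
  simp only [Finset.mem_filter, Finset.mem_univ, true_and, not_lt] at ha
  exact le_antisymm ha (hP.1 a)

/-- The Bhattacharyya coefficient is bounded through the total variation distance. -/
theorem sq_sum_sqrt_mul_le {α : Type*} [Fintype α] {P Q : α → ℝ}
    (hP : IsPMF P) (hQ : IsPMF Q) :
    (∑ a, √(P a) * √(Q a)) ^ 2 ≤ 1 - tvDist P Q ^ 2 := by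
  have hcs := Finset.sum_mul_sq_le_sq_mul_sq Finset.univ
    (fun a => |√(P a) - √(Q a)|) (fun a => √(P a) + √(Q a))
  have h1 : ∑ a, |√(P a) - √(Q a)| * (√(P a) + √(Q a)) = ∑ a, |P a - Q a| := by
    refine Finset.sum_congr rfl fun a _ => ?_
    have h0 : 0 ≤ √(P a) + √(Q a) := by positivity
    have hfac : P a - Q a = (√(P a) - √(Q a)) * (√(P a) + √(Q a)) := by
      nlinarith [Real.sq_sqrt (hP.1 a), Real.sq_sqrt (hQ.1 a)]
    rw [hfac, abs_mul, abs_of_nonneg h0]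
  have h2 : ∑ a, |√(P a) - √(Q a)| ^ 2 = 2 - 2 * ∑ a, √(P a) * √(Q a) := by
    have : ∀ a, |√(P a) - √(Q a)| ^ 2 = P a + Q a - 2 * (√(P a) * √(Q a)) := fun a => by
      rw [sq_abs]
      nlinarith [Real.sq_sqrt (hP.1 a), Real.sq_sqrt (hQ.1 a)]
    simp only [this, Finset.sum_sub_distrib, Finset.sum_add_distrib, ← Finset.mul_sum, hP.2, hQ.2]
    ring
  have h3 : ∑ a, (√(P a) + √(Q a)) ^ 2 = 2 + 2 * ∑ a, √(P a) * √(Q a) := by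
    have : ∀ a, (√(P a) + √(Q a)) ^ 2 = P a + Q a + 2 * (√(P a) * √(Q a)) := fun a => by
      nlinarith [Real.sq_sqrt (hP.1 a), Real.sq_sqrt (hQ.1 a)]
    simp only [this, Finset.sum_add_distrib, ← Finset.mul_sum, hP.2, hQ.2]
    ring
  rw [h1, h2, h3] at hcs
  unfold tvDist
  nlinarith

theorem sum_sqrt_mul_pos {α : Type*} [Fintype α] {P Q : α → ℝ} (hP : IsPMF P)
    (hPQ : ∀ a, 0 < P a → 0 < Q a) : 0 < ∑ a, √(P a) * √(Q a) := by
  obtain ⟨a, -, ha⟩ : ∃ a ∈ Finset.univ, 0 < P a :=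
    Finset.exists_lt_of_sum_lt (by simp [hP.2])
  refine Finset.sum_pos' (fun a _ => by positivity) ⟨a, Finset.mem_univ a, ?_⟩
  exact mul_pos (Real.sqrt_pos.2 ha) (Real.sqrt_pos.2 (hPQ a ha))

/-- The relative entropy dominates the Rényi divergence of order `1 / 2`. -/
theorem neg_log_sq_sum_sqrt_mul_le {α : Type*} [Fintype α] {P Q : α → ℝ} (hP : IsPMF P)
    (hPQ : ∀ a, 0 < P a → 0 < Q a) :
    -Real.log ((∑ a, √(P a) * √(Q a)) ^ 2) ≤
      ∑ a ∈ Finset.univ.filter (fun a => 0 < P a), P a * Real.log (P a / Q a) := by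
  have hpos : ∀ a ∈ Finset.univ.filter (fun a => 0 < P a), 0 < P a := fun a ha =>
    (Finset.mem_filter.1 ha).2
  have h := sum_mul_log_le_log_sum _ P (fun a => √(Q a / P a))
    (fun a ha => (hpos a ha).le) hP.sum_support
    (fun a ha => Real.sqrt_pos.2 (div_pos (hPQ a (hpos a ha)) (hpos a ha)))
  have h1 : ∑ a ∈ Finset.univ.filter (fun a => 0 < P a), P a * √(Q a / P a) =
      ∑ a, √(P a) * √(Q a) := by
    rw [← Finset.sum_subset (Finset.filter_subset (fun a => 0 < P a) Finset.univ)]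
    · refine Finset.sum_congr rfl fun a ha => ?_
      have ha := hpos a ha
      have hs := Real.sqrt_pos.2 ha
      rw [Real.sqrt_div' _ ha.le]
      field_simp
      rw [Real.sq_sqrt ha.le, mul_comm]
    · intro a _ ha
      simp only [Finset.mem_filter, Finset.mem_univ, true_and, not_lt] at ha
      simp [Real.sqrt_eq_zero_of_nonpos ha]
  have h2 : ∑ a ∈ Finset.univ.filter (fun a => 0 < P a), P a * Real.log (√(Q a / P a)) =
      -(1 / 2) * ∑ a ∈ Finset.univ.filter (fun a => 0 < P a), P a * Real.log (P a / Q a) := by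
    rw [Finset.mul_sum]
    refine Finset.sum_congr rfl fun a ha => ?_
    have ha := hpos a ha
    have hb := hPQ a ha
    rw [Real.log_sqrt (by positivity), Real.log_div hb.ne' ha.ne', Real.log_div ha.ne' hb.ne']
    ring
  rw [h1, h2] at h
  rw [Real.log_pow]
  push_cast
  linarith

/-- The relative entropy is at most the Rényi divergence of order `1 + s` for `s > 0`. -/
theorem relEntropy_le_renyi {α : Type*} [Fintype α] {P Q : α → ℝ} (hP : IsPMF P)
    (hPQ : ∀ a, 0 < P a → 0 < Q a) {s : ℝ} (hs : 0 < s) :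
    ∑ a ∈ Finset.univ.filter (fun a => 0 < P a), P a * Real.log (P a / Q a) ≤
      (1 / s) * Real.log (∑ a ∈ Finset.univ.filter (fun a => 0 < P a),
        P a ^ (1 + s) * Q a ^ (-s)) := by
  have hpos : ∀ a ∈ Finset.univ.filter (fun a => 0 < P a), 0 < P a := fun a ha =>
    (Finset.mem_filter.1 ha).2
  have h := sum_mul_log_le_log_sum _ P (fun a => (P a / Q a) ^ s)
    (fun a ha => (hpos a ha).le) hP.sum_support
    (fun a ha => Real.rpow_pos_of_pos (div_pos (hpos a ha) (hPQ a (hpos a ha))) s)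
  have h1 : ∑ a ∈ Finset.univ.filter (fun a => 0 < P a), P a * (P a / Q a) ^ s =
      ∑ a ∈ Finset.univ.filter (fun a => 0 < P a), P a ^ (1 + s) * Q a ^ (-s) := by
    refine Finset.sum_congr rfl fun a ha => ?_
    have ha := hpos a ha
    have hb := hPQ a ha
    rw [Real.div_rpow ha.le hb.le, Real.rpow_add ha, Real.rpow_one, Real.rpow_neg hb.le]
    ring
  have h2 : ∑ a ∈ Finset.univ.filter (fun a => 0 < P a), P a * Real.log ((P a / Q a) ^ s) =
      s * ∑ a ∈ Finset.univ.filter (fun a => 0 < P a), P a * Real.log (P a / Q a) := by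
    rw [Finset.mul_sum]
    refine Finset.sum_congr rfl fun a ha => ?_
    rw [Real.log_rpow (div_pos (hpos a ha) (hPQ a (hpos a ha)))]
    ring
  rw [h1, h2] at h
  rwa [one_div_mul_eq_div, le_div_iff₀' hs]

/-- Improved lower bound on the Rényi divergence in terms of total variation: for every
`s ∈ [0,∞)`, `ε ∈ [0,1]`, and probability distributions `P, Q` on a common finite
alphabet with `|P − Q| ≥ ε`, one has `D_{1+s}(P‖Q) ≥ [log(1/(4(1−ε)))]⁺`, the right-hand
side being `+∞` when `ε = 1`. -/
theorem renyi_lower_bound_from_tv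
    {α : Type*} [Fintype α] (s : ℝ) (hs : 0 ≤ s)
    (ε : ℝ) (hε : ε ∈ Set.Icc (0 : ℝ) 1)
    (P Q : α → ℝ) (hP : IsPMF P) (hQ : IsPMF Q)
    (htv : ε ≤ tvDist P Q) :
    (if ε = 1 then (⊤ : EReal)
      else ((max (Real.log (1 / (4 * (1 - ε)))) 0 : ℝ) : EReal)) ≤ renyiDiv s P Q := by
  by_cases hsupp : ∃ a, 0 < P a ∧ Q a = 0
  · have htop : renyiDiv s P Q = ⊤ := if_pos ⟨hs, hsupp⟩
    rw [htop]
    exact le_top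
  have hPQ : ∀ a, 0 < P a → 0 < Q a := fun a ha =>
    lt_of_le_of_ne (hQ.1 a) fun h => hsupp ⟨a, ha, h.symm⟩
  obtain ⟨h0, h1⟩ := hε
  have hB : 0 < (∑ a, √(P a) * √(Q a)) ^ 2 := pow_pos (sum_sqrt_mul_pos hP hPQ) 2
  have hBε : (∑ a, √(P a) * √(Q a)) ^ 2 ≤ 1 - ε ^ 2 := by
    nlinarith [sq_sum_sqrt_mul_le hP hQ]
  have hne : ε ≠ 1 := by
    rintro rfl
    linarith
  have hlt : ε < 1 := lt_of_le_of_ne h1 hne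
  have hmax : max (Real.log (1 / (4 * (1 - ε)))) 0 ≤
      -Real.log ((∑ a, √(P a) * √(Q a)) ^ 2) := by
    refine max_le ?_ ?_
    · rw [one_div, Real.log_inv, neg_le_neg_iff]
      exact Real.log_le_log hB (by nlinarith)
    · exact neg_nonneg.2 (Real.log_nonpos hB.le (by nlinarith))
  have hD := hmax.trans (neg_log_sq_sum_sqrt_mul_le hP hPQ)
  rw [if_neg hne, renyiDiv, if_neg fun h => hsupp h.2]
  split_ifs with hs0
  · exact EReal.coe_le_coe_iff.2 hD
  · exact EReal.coe_le_coe_iff.2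
      (hD.trans (relEntropy_le_renyi hP hPQ (lt_of_le_of_ne hs (Ne.symm hs0))))
end
end
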